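/- No weakly 3-random set has uniformly introenumerable enumeration degree. -/

import Mathlib

open MeasureTheory

/-- A set (of any primcodable type) is computably enumerable. -/
def CE {α : Type*} [Primcodable α] (S : Set α) : Prop :=
  ∃ f : α →. ℕ, Partrec f ∧ S = f.Dom

/-- The `y`-th finite set in a canonical listing of all finite subsets of `ℕ`. -/
def Dfin (y : ℕ) : Set ℕ := ↑(Denumerable.ofNat (Finset ℕ) y)

/-- Application of the enumeration operator with c.e. index set `W` to an oracle `X`. -/
def enumOp (W : Set ℕ) (X : Set ℕ) : Set ℕ :=
  {x | ∃ y, Nat.pair x y ∈ W ∧ Dfin y ⊆ X}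

/-- Enumeration reducibility. -/
def EnumRed (A B : Set ℕ) : Prop := ∃ W : Set ℕ, CE W ∧ A = enumOp W B

/-- Enumeration equivalence. -/
def EnumEquiv (A B : Set ℕ) : Prop := EnumRed A B ∧ EnumRed B A

/-- Application of a hyper-enumeration operator with c.e. index set `W` to an oracle `X`. -/
def henumOp (W : Set ℕ) (X : Set ℕ) : Set ℕ :=
  {x | ∀ f : List ℕ, ∃ n y,
    Nat.pair (Encodable.encode (f.take n)) (Nat.pair x y) ∈ W ∧ Dfin y ⊆ X}

/-- Hyper-enumeration reducibility. -/
def HypEnumRed (B A : Set ℕ) : Prop := ∃ W : Set ℕ, CE W ∧ B = henumOp W A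

def Cototal (A : Set ℕ) : Prop := EnumRed A Aᶜ

def HypCototal (A : Set ℕ) : Prop := HypEnumRed A Aᶜ

def UnifIntroenum (X : Set ℕ) : Prop :=
  X.Infinite ∧ ∃ W : Set ℕ, CE W ∧ ∀ Y ⊆ X, Y.Infinite → enumOp W Y = X

def Introenum (X : Set ℕ) : Prop :=
  X.Infinite ∧ ∀ Y ⊆ X, Y.Infinite → ∃ W : Set ℕ, CE W ∧ enumOp W Y = X

/-- View a point of Cantor space as a subset of `ℕ`. -/
def toSet (A : ℕ → Bool) : Set ℕ := {n | A n = true}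

/-- Remove `n` from (the set coded by) `A`. -/
def drop (A : ℕ → Bool) (n : ℕ) : ℕ → Bool := fun m => if m = n then false else A m

/-- `A` is `Ψ`-autoreducible. -/
def AutoRed (Ψ : ℕ → (ℕ → Bool) → Bool) (A : ℕ → Bool) : Prop :=
  ∀ n, A n = Ψ n (drop A n)

/-- The basic clopen cylinder of a finite binary string. -/
def cyl (σ : List Bool) : Set (ℕ → Bool) := {A | ∀ i : Fin σ.length, A i = σ.get i}

/-- `μ` is the uniform (fair-coin) measure on Cantor space: it gives each cylinder
of a string of length `k` measure `2⁻ᵏ`.  (This characterizes the measure uniquely.) -/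
def IsCoinMeasure (μ : Measure (ℕ → Bool)) : Prop :=
  ∀ σ : List Bool, μ (cyl σ) = 2⁻¹ ^ σ.length

/-- The first `k` bits of `A`. -/
def res (A : ℕ → Bool) (k : ℕ) : List Bool := List.ofFn fun i : Fin k => A i

/-- A `Π⁰₂` class in Cantor space. -/
def IsPi02 (C : Set (ℕ → Bool)) : Prop :=
  ∃ R : ℕ → List Bool → Bool, Computable (fun p : ℕ × List Bool => R p.1 p.2) ∧
    C = {A | ∀ m, ∃ k, R m (res A k) = true}

/-- A `Π⁰₃` class in Cantor space. -/
def IsPi03 (C : Set (ℕ → Bool)) : Prop :=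
  ∃ R : ℕ → ℕ → List Bool → Bool,
    Computable (fun p : ℕ × ℕ × List Bool => R p.1 p.2.1 p.2.2) ∧
    C = {A | ∀ m, ∃ k, ∀ j, R m k (res A j) = true}

/-- The `m`-th level of the open test determined by the c.e. set `W` of pairs. -/
def testSet (W : Set (ℕ × List Bool)) (m : ℕ) : Set (ℕ → Bool) :=
  ⋃ σ ∈ {σ | (m, σ) ∈ W}, cyl σ

/-- Martin-Löf randomness (with respect to a measure `μ` on Cantor space). -/
def MLRandom (μ : Measure (ℕ → Bool)) (A : ℕ → Bool) : Prop :=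
  ∀ W : Set (ℕ × List Bool), CE W →
    (∀ m, μ (testSet W m) ≤ 2⁻¹ ^ m) → ∃ m, A ∉ testSet W m

/-- 2-randomness: passing all uniformly `Σ⁰₂` tests. -/
def TwoRandom (μ : Measure (ℕ → Bool)) (A : ℕ → Bool) : Prop :=
  ∀ R : ℕ → ℕ → List Bool → Bool,
    Computable (fun p : ℕ × ℕ × List Bool => R p.1 p.2.1 p.2.2) →
    (∀ m, μ {A | ∃ k, ∀ j, R m k (res A j) = true} ≤ 2⁻¹ ^ m) →
    ∃ m, A ∉ {A | ∃ k, ∀ j, R m k (res A j) = true}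

/-- Weak 2-randomness: avoiding every null `Π⁰₂` class. -/
def Weak2Random (μ : Measure (ℕ → Bool)) (A : ℕ → Bool) : Prop :=
  ∀ C : Set (ℕ → Bool), IsPi02 C → μ C = 0 → A ∉ C

/-- Weak 3-randomness: avoiding every null `Π⁰₃` class. -/
def Weak3Random (μ : Measure (ℕ → Bool)) (A : ℕ → Bool) : Prop :=
  ∀ C : Set (ℕ → Bool), IsPi03 C → μ C = 0 → A ∉ C

/-! ### Measure part -/

def flipAt (n : ℕ) (Z : ℕ → Bool) : ℕ → Bool := fun m => if m = n then !(Z m) else Z m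

lemma flipAt_flipAt (n : ℕ) (Z : ℕ → Bool) : flipAt n (flipAt n Z) = Z := by
  funext m; by_cases h : m = n <;> simp [flipAt, h]

lemma drop_flipAt (n : ℕ) (Z : ℕ → Bool) : drop (flipAt n Z) n = drop Z n := by
  funext m; by_cases h : m = n <;> simp [drop, flipAt, h]

lemma measurable_flipAt (n : ℕ) : Measurable (flipAt n) := by
  refine measurable_pi_lambda _ fun m => ?_
  by_cases h : m = n
  · simp only [flipAt, h, if_true]
    exact (measurable_of_finite (fun b : Bool => !b)).comp (measurable_pi_apply n)
  · simp only [flipAt, h, if_false]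
    exact measurable_pi_apply m

lemma cyl_res (x : ℕ → Bool) (k : ℕ) : cyl (res x k) = PiNat.cylinder x k := by
  ext y
  simp only [cyl, PiNat.cylinder, Set.mem_ofPred_eq]
  constructor
  · intro h i hi
    have := h ⟨i, by simpa [res] using hi⟩
    simpa [res] using this
  · rintro h ⟨i, hi⟩
    have := h i (by simpa [res] using hi)
    simpa [res] using this

lemma coin_cylinder {μ : Measure (ℕ → Bool)} (hμ : IsCoinMeasure μ) (x : ℕ → Bool) (k : ℕ) :
    μ (PiNat.cylinder x k) = 2⁻¹ ^ k := by
  rw [← cyl_res, hμ]; simp [res]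

lemma coin_univ {μ : Measure (ℕ → Bool)} (hμ : IsCoinMeasure μ) : μ Set.univ = 1 := by
  have := coin_cylinder hμ (fun _ => false) 0
  simpa using this

lemma preimage_flipAt_cylinder (n : ℕ) (x : ℕ → Bool) (k : ℕ) :
    flipAt n ⁻¹' (PiNat.cylinder x k) = PiNat.cylinder (flipAt n x) k := by
  ext y
  simp only [Set.mem_preimage, PiNat.mem_cylinder_iff]
  refine forall₂_congr fun i _ => ?_
  by_cases h : i = n
  · simp only [flipAt, h, if_true]; cases y n <;> cases x n <;> simp
  · simp [flipAt, h]

lemma map_flipAt {μ : Measure (ℕ → Bool)} (hμ : IsCoinMeasure μ) (n : ℕ) :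
    μ.map (flipAt n) = μ := by
  have : IsProbabilityMeasure μ := ⟨coin_univ hμ⟩
  refine (ext_of_generate_finite
    {s : Set (ℕ → Bool) | ∃ (x : ℕ → Bool) (n : ℕ), s = PiNat.cylinder x n} ?_ ?_ ?_ ?_).symm
  · rw [← (PiNat.isTopologicalBasis_cylinders (E := fun _ => Bool)).borel_eq_generateFrom]
    exact BorelSpace.measurable_eq
  · rintro s ⟨x, k, rfl⟩ t ⟨y, l, rfl⟩ ⟨z, hz1, hz2⟩
    rw [PiNat.mem_cylinder_iff_eq] at hz1 hz2
    rw [← hz1, ← hz2]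
    rcases le_total k l with h | h
    · exact ⟨z, l, Set.inter_eq_right.2 (PiNat.cylinder_anti z h)⟩
    · exact ⟨z, k, Set.inter_eq_left.2 (PiNat.cylinder_anti z h)⟩
  · rintro s ⟨x, k, rfl⟩
    rw [Measure.map_apply (measurable_flipAt n) (PiNat.isOpen_cylinder _ x k).measurableSet,
      preimage_flipAt_cylinder, coin_cylinder hμ, coin_cylinder hμ]
  · rw [Measure.map_apply (measurable_flipAt n) MeasurableSet.univ, Set.preimage_univ]

lemma null_of_flip {μ : Measure (ℕ → Bool)} (hμ : IsCoinMeasure μ) (C : Set (ℕ → Bool))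
    (hC : MeasurableSet C) (hflip : ∀ n, ∀ Z ∈ C, flipAt n Z ∉ C) : μ C = 0 := by
  have : IsProbabilityMeasure μ := ⟨coin_univ hμ⟩
  -- key estimate on open sets
  have key : ∀ U : Set (ℕ → Bool), IsOpen U → 2 * μ (C ∩ U) ≤ μ U := by
    intro U hU
    let E : ℕ → Set (ℕ → Bool) := fun k => {Z | PiNat.cylinder Z k ⊆ U}
    have hEmono : Monotone E := fun k l h Z hZ => (PiNat.cylinder_anti Z h).trans hZ
    have hEopen : ∀ k, IsOpen (E k) := by
      intro k
      rw [isOpen_iff_forall_mem_open]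
      intro Z hZ
      refine ⟨PiNat.cylinder Z k, ?_, PiNat.isOpen_cylinder _ Z k, PiNat.self_mem_cylinder Z k⟩
      intro Y hY
      rw [PiNat.mem_cylinder_iff_eq] at hY
      change PiNat.cylinder Y k ⊆ U
      rw [hY]; exact hZ
    have hEU : (⋃ k, E k) = U := by
      ext Z
      constructor
      · intro hZ
        obtain ⟨k, hk⟩ := Set.mem_iUnion.1 hZ
        exact hk (PiNat.self_mem_cylinder Z k)
      · intro hZ
        obtain ⟨v, ⟨x, k, rfl⟩, hx, hv⟩ :=
          (PiNat.isTopologicalBasis_cylinders (E := fun _ => Bool)).exists_subset_of_mem_open hZ hU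
        rw [PiNat.mem_cylinder_iff_eq] at hx
        refine Set.mem_iUnion.2 ⟨k, ?_⟩
        change PiNat.cylinder Z k ⊆ U
        rw [hx]; exact hv
    have hE : ∀ k, 2 * μ (C ∩ E k) ≤ μ (E k) := by
      intro k
      have hm : MeasurableSet (C ∩ E k) := hC.inter (hEopen k).measurableSet
      have h1 : μ (flipAt k ⁻¹' (C ∩ E k)) = μ (C ∩ E k) := by
        rw [← Measure.map_apply (measurable_flipAt k) hm, map_flipAt hμ]
      have hdis : Disjoint (C ∩ E k) (flipAt k ⁻¹' (C ∩ E k)) := by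
        rw [Set.disjoint_left]
        rintro Z ⟨hZ, _⟩ ⟨hZ', _⟩
        exact hflip k Z hZ hZ'
      calc 2 * μ (C ∩ E k) = μ (C ∩ E k) + μ (flipAt k ⁻¹' (C ∩ E k)) := by rw [h1, two_mul]
        _ = μ ((C ∩ E k) ∪ flipAt k ⁻¹' (C ∩ E k)) :=
          (measure_union hdis (measurable_flipAt k hm)).symm
        _ ≤ μ (E k) := by
          refine measure_mono (Set.union_subset Set.inter_subset_right ?_)
          rintro Z ⟨_, hZ⟩
          have e : PiNat.cylinder Z k = PiNat.cylinder (flipAt k Z) k := by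
            rw [← PiNat.mem_cylinder_iff_eq, PiNat.mem_cylinder_iff]
            intro i hi
            simp [flipAt, hi.ne]
          change PiNat.cylinder Z k ⊆ U
          rw [e]; exact hZ
    have hl : μ (C ∩ U) = ⨆ k, μ (C ∩ E k) := by
      rw [← hEU, Set.inter_iUnion]
      exact Monotone.measure_iUnion fun k l h => Set.inter_subset_inter_right _ (hEmono h)
    rw [hl, ENNReal.mul_iSup]
    refine iSup_le fun k => (hE k).trans (measure_mono ?_)
    rw [← hEU]; exact Set.subset_iUnion E k
  have h2 : 2 * μ C ≤ μ C := by
    refine ENNReal.le_of_forall_pos_le_add fun ε hε _ => ?_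
    obtain ⟨U, hUC, hU, hle⟩ := C.exists_isOpen_le_add μ (ε := (ε : ENNReal)) (by simpa using hε.ne')
    have := key U hU
    rw [Set.inter_eq_left.2 hUC] at this
    exact this.trans hle
  have hfin : μ C ≠ ⊤ := measure_ne_top μ C
  rw [two_mul] at h2
  by_contra h0
  exact absurd h2 (not_le.2 (ENNReal.lt_add_right hfin h0))

lemma measurableSet_res (j : ℕ) (P : List Bool → Prop) :
    MeasurableSet {Z : ℕ → Bool | P (res Z j)} := by
  have : {Z : ℕ → Bool | P (res Z j)} =
      (fun Z : ℕ → Bool => fun i : Fin j => Z i) ⁻¹' {x | P (List.ofFn x)} := rfl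
  rw [this]
  exact (measurable_pi_lambda _ fun i => measurable_pi_apply _) (Set.toFinite _).measurableSet

lemma IsPi03.measurableSet {C : Set (ℕ → Bool)} (h : IsPi03 C) : MeasurableSet C := by
  obtain ⟨R, _, rfl⟩ := h
  simp only [Set.ofPred_forall, Set.ofPred_exists]
  exact .iInter fun m => .iUnion fun k => .iInter fun j =>
    measurableSet_res j (fun σ => R m k σ = true)

/-! ### Computability part -/

/-- The list of elements of the `y`-th finite set. -/
def DL (y : ℕ) : List ℕ := Denumerable.raise' (Denumerable.ofNat (List ℕ) y) 0

lemma mem_Dfin (y z : ℕ) : z ∈ Dfin y ↔ z ∈ DL y := by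
  have h : Denumerable.ofNat (Finset ℕ) y =
      Finset.map (Denumerable.eqv ℕ).symm.toEmbedding
        (Denumerable.raise'Finset (Denumerable.ofNat (List ℕ) y) 0) := rfl
  have h2 : ∀ w, (Denumerable.eqv ℕ).symm w = w := fun w => rfl
  simp only [Dfin, h, Finset.mem_coe, Finset.mem_map, Equiv.coe_toEmbedding, h2, DL,
    exists_eq_right]
  exact Iff.rfl

def raiseStep (st : List ℕ × ℕ) (m : ℕ) : List ℕ × ℕ := (st.1 ++ [m + st.2], m + st.2 + 1)

lemma raise_foldl (l : List ℕ) : ∀ (acc : List ℕ) (n : ℕ),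
    (l.foldl raiseStep (acc, n)).1 = acc ++ Denumerable.raise' l n := by
  induction l with
  | nil => intro acc n; simp [Denumerable.raise']
  | cons m l ih => intro acc n; simp [raiseStep, Denumerable.raise', ih]

lemma primrec_DL : Primrec DL := by
  have hstep : Primrec₂ (fun (_ : ℕ) (p : (List ℕ × ℕ) × ℕ) => raiseStep p.1 p.2) := by
    have h1 : Primrec fun q : ℕ × ((List ℕ × ℕ) × ℕ) => q.2.2 + q.2.1.2 :=
      Primrec.nat_add.comp (Primrec.snd.comp Primrec.snd)
        (Primrec.snd.comp (Primrec.fst.comp Primrec.snd))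
    exact Primrec.pair
      (Primrec.list_concat.comp (Primrec.fst.comp (Primrec.fst.comp Primrec.snd)) h1)
      (Primrec.succ.comp h1)
  have := Primrec.fst.comp
    (Primrec.list_foldl (Primrec.ofNat (List ℕ)) (Primrec.const (([] : List ℕ), 0)) hstep)
  exact this.of_eq fun y => by
    have := raise_foldl (Denumerable.ofNat (List ℕ) y) [] 0
    simpa [DL] using this

lemma CE.stage {W : Set ℕ} (h : CE W) : ∃ R : ℕ → ℕ → Prop, PrimrecRel R ∧
    (∀ n s t, s ≤ t → R n s → R n t) ∧ ∀ n, n ∈ W ↔ ∃ s, R n s := by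
  obtain ⟨f, hf, rfl⟩ := h
  obtain ⟨c, rfl⟩ := Nat.Partrec.Code.exists_code.1 (Partrec.nat_iff.1 hf)
  refine ⟨fun n s => (Nat.Partrec.Code.evaln s c n).isSome = true, ?_, ?_, ?_⟩
  · have h1 : Primrec fun p : ℕ × ℕ => (Nat.Partrec.Code.evaln p.2 c p.1).isSome :=
      Primrec.option_isSome.comp (Nat.Partrec.Code.primrec_evaln.comp
        ((Primrec.snd.pair (Primrec.const c)).pair Primrec.fst))
    exact Primrec.eq.comp h1 (Primrec.const true)
  · intro n s t hst h
    obtain ⟨x, hx⟩ := Option.isSome_iff_exists.1 h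
    exact Option.isSome_iff_exists.2 ⟨x, Nat.Partrec.Code.evaln_mono hst hx⟩
  · intro n
    rw [PFun.mem_dom]
    constructor
    · rintro ⟨y, hy⟩
      obtain ⟨k, hk⟩ := Nat.Partrec.Code.evaln_complete.1 hy
      exact ⟨k, Option.isSome_iff_exists.2 ⟨y, hk⟩⟩
    · rintro ⟨k, hk⟩
      obtain ⟨y, hy⟩ := Option.isSome_iff_exists.1 hk
      exact ⟨y, Nat.Partrec.Code.evaln_sound hy⟩

lemma exists_lt_gen {α : Type*} [Primcodable α] {R : ℕ → α → Prop} (hf : PrimrecRel R) :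
    PrimrecRel fun n y ↦ ∃ x < n, R x y :=
  (hf.exists_mem_list.comp (Primrec.list_range.comp Primrec.fst) Primrec.snd).of_eq (by simp)

lemma forall_lt_gen {α : Type*} [Primcodable α] {R : ℕ → α → Prop} (hf : PrimrecRel R) :
    PrimrecRel fun n y ↦ ∀ x < n, R x y :=
  (hf.forall_mem_list.comp (Primrec.list_range.comp Primrec.fst) Primrec.snd).of_eq (by simp)

/-- Stage-`s` approximation to an enumeration operator. -/
def opS (R : ℕ → ℕ → Prop) (s : ℕ) (P : ℕ → Prop) (x : ℕ) : Prop :=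
  ∃ y < s, R (Nat.pair x y) s ∧ ∀ z ∈ DL y, P z

lemma primrec_opS {α : Type*} [Primcodable α] {R : ℕ → ℕ → Prop} (hR : PrimrecRel R)
    {s : α → ℕ} (hs : Primrec s) {P : α → ℕ → Prop} (hP : PrimrecRel P) :
    PrimrecRel fun a x => opS R (s a) (P a) x := by
  have h1 : PrimrecRel fun (y : ℕ) (p : α × ℕ) =>
      R (Nat.pair p.2 y) (s p.1) ∧ ∀ z ∈ DL y, P p.1 z := by
    refine PrimrecPred.and ?_ ?_
    · exact hR.comp (Primrec₂.natPair.comp (Primrec.snd.comp Primrec.snd) Primrec.fst)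
        (hs.comp (Primrec.fst.comp Primrec.snd))
    · have h2 : PrimrecRel fun (z : ℕ) (a : α) => P a z := hP.comp Primrec.snd Primrec.fst
      exact h2.forall_mem_list.comp (primrec_DL.comp Primrec.fst) (Primrec.fst.comp Primrec.snd)
  exact (exists_lt_gen h1).comp (hs.comp Primrec.fst) Primrec.id

lemma opS_mono {R : ℕ → ℕ → Prop} (hR : ∀ n s t, s ≤ t → R n s → R n t) {s t : ℕ} (hst : s ≤ t)
    {P Q : ℕ → Prop} (hPQ : ∀ z, P z → Q z) {x : ℕ} (h : opS R s P x) : opS R t Q x := by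
  obtain ⟨y, hy, h1, h2⟩ := h
  exact ⟨y, hy.trans_le hst, hR _ _ _ hst h1, fun z hz => hPQ z (h2 z hz)⟩

lemma list_bound {P : ℕ → ℕ → Prop} (hP : ∀ s t z, s ≤ t → P s z → P t z) (l : List ℕ)
    (h : ∀ z ∈ l, ∃ s, P s z) : ∃ s, ∀ z ∈ l, P s z := by
  induction l with
  | nil => exact ⟨0, by simp⟩
  | cons a l ih =>
    obtain ⟨s, hs⟩ := ih fun z hz => h z (List.mem_cons_of_mem _ hz)
    obtain ⟨t, ht⟩ := h a List.mem_cons_self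
    refine ⟨max s t, fun z hz => ?_⟩
    rcases List.mem_cons.1 hz with rfl | hz
    · exact hP _ _ _ (le_max_right _ _) ht
    · exact hP _ _ _ (le_max_left _ _) (hs z hz)

lemma opS_lim {R : ℕ → ℕ → Prop} (hR : ∀ n s t, s ≤ t → R n s → R n t) {W : Set ℕ}
    (hW : ∀ n, n ∈ W ↔ ∃ s, R n s) {P : ℕ → ℕ → Prop} (hP : ∀ s t z, s ≤ t → P s z → P t z)
    {X : Set ℕ} (hX : ∀ z, z ∈ X ↔ ∃ s, P s z) (x : ℕ) :
    x ∈ enumOp W X ↔ ∃ s, opS R s (P s) x := by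
  constructor
  · rintro ⟨y, hy, hD⟩
    obtain ⟨s, hs⟩ := (hW _).1 hy
    obtain ⟨t, ht⟩ := list_bound hP (DL y) fun z hz => (hX z).1 (hD ((mem_Dfin y z).2 hz))
    refine ⟨max (max s t) (y + 1), y, by omega, hR _ _ _ (by omega) hs, fun z hz => ?_⟩
    exact hP _ _ _ (by omega) (ht z hz)
  · rintro ⟨s, y, _, h1, h2⟩
    exact ⟨y, (hW _).2 ⟨s, h1⟩, fun z hz => (hX z).2 ⟨s, h2 z ((mem_Dfin y z).1 hz)⟩⟩

lemma enumOp_mono {W X Y : Set ℕ} (h : X ⊆ Y) : enumOp W X ⊆ enumOp W Y := by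
  rintro x ⟨y, hy, hD⟩
  exact ⟨y, hy, hD.trans h⟩

lemma res_getElem (Z : ℕ → Bool) (j n : ℕ) (b : Bool) :
    (res Z j)[n]? = some b ↔ n < j ∧ Z n = b := by
  simp only [res, List.getElem?_ofFn]
  by_cases h : n < j <;> simp [h]

lemma res_length (Z : ℕ → Bool) (j : ℕ) : (res Z j).length = j := by simp [res]

/-- Stage `s` of `Z \ {n}`, read off from a string. -/
def baseL (a : ℕ × ℕ × List Bool) (x : ℕ) : Prop :=
  x < a.2.1 ∧ a.2.2[x]? = some true ∧ x ≠ a.1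

def baseZ (n : ℕ) (Z : ℕ → Bool) (s x : ℕ) : Prop := x < s ∧ Z x = true ∧ x ≠ n

lemma primrec_baseL : PrimrecRel baseL := by
  refine PrimrecPred.and ?_ (PrimrecPred.and ?_ (PrimrecPred.not ?_))
  · exact Primrec.nat_lt.comp Primrec.snd (Primrec.fst.comp (Primrec.snd.comp Primrec.fst))
  · exact Primrec.eq.comp (Primrec.list_getElem?.comp
      (Primrec.snd.comp (Primrec.snd.comp Primrec.fst)) Primrec.snd) (Primrec.const (some true))
  · exact Primrec.eq.comp Primrec.snd (Primrec.fst.comp Primrec.fst)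

lemma baseL_res (n s j : ℕ) (Z : ℕ → Bool) (h : s ≤ j) : baseL (n, s, res Z j) = baseZ n Z s := by
  funext x
  apply propext
  simp only [baseL, baseZ, res_getElem]
  constructor
  · rintro ⟨h1, ⟨_, h2⟩, h3⟩; exact ⟨h1, h2, h3⟩
  · rintro ⟨h1, h2, h3⟩; exact ⟨h1, ⟨h1.trans_le h, h2⟩, h3⟩

lemma baseZ_mono (n : ℕ) (Z : ℕ → Bool) (s t z : ℕ) (h : s ≤ t) (hz : baseZ n Z s z) :
    baseZ n Z t z := ⟨hz.1.trans_le h, hz.2⟩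

lemma baseZ_lim (n : ℕ) (Z : ℕ → Bool) (z : ℕ) :
    z ∈ toSet (drop Z n) ↔ ∃ s, baseZ n Z s z := by
  constructor
  · intro h
    have h : (if z = n then false else Z z) = true := h
    by_cases hz : z = n
    · simp [hz] at h
    · exact ⟨z + 1, Nat.lt_succ_self z, by simpa [hz] using h, hz⟩
  · rintro ⟨s, _, h2, h3⟩
    change (if z = n then false else Z z) = true
    simpa [h3] using h2

/-- Abstract form of the `Π⁰₃` normal form of the autoreducible class. -/
lemma pi03_aux (T1 : ℕ × ℕ × List Bool → Prop) (T2 : ℕ × ℕ × List Bool → ℕ → Prop)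
    (h1 : PrimrecPred T1) (h2 : PrimrecRel T2)
    (t1 : (ℕ → Bool) → ℕ → ℕ → Prop) (t2 : (ℕ → Bool) → ℕ → ℕ → ℕ → Prop)
    (e1 : ∀ Z n s j, s ≤ j → (T1 (n, s, res Z j) ↔ t1 Z n s))
    (e2 : ∀ Z n s j x, s ≤ j → (T2 (n, s, res Z j) x ↔ t2 Z n s x))
    (m1 : ∀ Z n s t, s ≤ t → t1 Z n s → t1 Z n t)
    (m2 : ∀ Z n s t x, s ≤ t → t2 Z n s x → t2 Z n t x) :
    IsPi03 {Z | ∀ n, (Z n = true → (∃ s, t1 Z n s) ∨ ∃ k, ∀ x, k ≤ x → ∀ s, ¬ t2 Z n s x) ∧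
      (Z n = false → ∀ s, ¬ t1 Z n s) ∧
      (Z n = false → ∀ q, ∃ x, q ≤ x ∧ ∃ s, t2 Z n s x)} := by
  let Q : ℕ × ℕ × List Bool → Prop := fun p =>
    (p.2.2[p.1.unpair.1]? ≠ some true ∨
      (p.2.2.length < p.2.1.unpair.1 ∨ T1 (p.1.unpair.1, p.2.1.unpair.1, p.2.2)) ∨
      ∀ x < p.2.2.length, x < p.2.1.unpair.1 ∨ ¬ T2 (p.1.unpair.1, p.2.2.length, p.2.2) x) ∧
    (p.2.2[p.1.unpair.1]? ≠ some false ∨ ¬ T1 (p.1.unpair.1, p.2.2.length, p.2.2)) ∧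
    (p.2.2[p.1.unpair.1]? ≠ some false ∨ p.2.2.length < p.2.1.unpair.2 ∨
      ∃ x < p.2.1.unpair.2, p.1.unpair.2 ≤ x ∧ T2 (p.1.unpair.1, p.2.1.unpair.2, p.2.2) x)
  have pn : Primrec fun p : ℕ × ℕ × List Bool => p.1.unpair.1 :=
    Primrec.fst.comp (Primrec.unpair.comp Primrec.fst)
  have pq : Primrec fun p : ℕ × ℕ × List Bool => p.1.unpair.2 :=
    Primrec.snd.comp (Primrec.unpair.comp Primrec.fst)
  have pk1 : Primrec fun p : ℕ × ℕ × List Bool => p.2.1.unpair.1 :=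
    Primrec.fst.comp (Primrec.unpair.comp (Primrec.fst.comp Primrec.snd))
  have pk2 : Primrec fun p : ℕ × ℕ × List Bool => p.2.1.unpair.2 :=
    Primrec.snd.comp (Primrec.unpair.comp (Primrec.fst.comp Primrec.snd))
  have pσ : Primrec fun p : ℕ × ℕ × List Bool => p.2.2 := Primrec.snd.comp Primrec.snd
  have pl : Primrec fun p : ℕ × ℕ × List Bool => p.2.2.length := Primrec.list_length.comp pσ
  have pb : ∀ b : Bool, PrimrecPred fun p : ℕ × ℕ × List Bool =>
      p.2.2[p.1.unpair.1]? ≠ some b := fun b =>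
    (Primrec.eq.comp (Primrec.list_getElem?.comp pσ pn) (Primrec.const (some b))).not
  have hQ : PrimrecPred Q := by
    refine PrimrecPred.and (PrimrecPred.or (pb true) (PrimrecPred.or (PrimrecPred.or ?_ ?_) ?_))
      (PrimrecPred.and (PrimrecPred.or (pb false) (PrimrecPred.not ?_))
      (PrimrecPred.or (pb false) (PrimrecPred.or ?_ ?_)))
    · exact Primrec.nat_lt.comp pl pk1
    · exact h1.comp (pn.pair (pk1.pair pσ))
    · have : PrimrecRel fun (x : ℕ) (p : ℕ × ℕ × List Bool) =>
          x < p.2.1.unpair.1 ∨ ¬ T2 (p.1.unpair.1, p.2.2.length, p.2.2) x := by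
        refine PrimrecPred.or ?_ (PrimrecPred.not ?_)
        · exact Primrec.nat_lt.comp Primrec.fst (pk1.comp Primrec.snd)
        · exact h2.comp ((pn.pair (pl.pair pσ)).comp Primrec.snd) Primrec.fst
      exact (forall_lt_gen this).comp pl Primrec.id
    · exact h1.comp (pn.pair (pl.pair pσ))
    · exact Primrec.nat_lt.comp pl pk2
    · have : PrimrecRel fun (x : ℕ) (p : ℕ × ℕ × List Bool) =>
          p.1.unpair.2 ≤ x ∧ T2 (p.1.unpair.1, p.2.1.unpair.2, p.2.2) x := by
        refine PrimrecPred.and ?_ ?_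
        · exact Primrec.nat_le.comp (pq.comp Primrec.snd) Primrec.fst
        · exact h2.comp ((pn.pair (pk2.pair pσ)).comp Primrec.snd) Primrec.fst
      exact (exists_lt_gen this).comp pk2 Primrec.id
  obtain ⟨dQ, hQ⟩ := hQ
  refine ⟨fun m k σ => decide (Q (m, k, σ)), hQ.to_comp, ?_⟩
  ext Z
  -- the meaning of `Q` along `Z`
  have hQZ : ∀ n q k1 k2 j, Q (Nat.pair n q, Nat.pair k1 k2, res Z j) ↔
      ((¬ (n < j ∧ Z n = true) ∨ (j < k1 ∨ t1 Z n k1) ∨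
        ∀ x < j, x < k1 ∨ ¬ t2 Z n j x) ∧
      (¬ (n < j ∧ Z n = false) ∨ ¬ t1 Z n j) ∧
      (¬ (n < j ∧ Z n = false) ∨ j < k2 ∨ ∃ x < k2, q ≤ x ∧ t2 Z n k2 x)) := by
    intro n q k1 k2 j
    simp only [Q, Nat.unpair_pair, ne_eq, res_getElem, res_length, e1 Z n j j le_rfl,
      e2 Z n j j _ le_rfl]
    have a1 : (j < k1 ∨ T1 (n, k1, res Z j)) ↔ (j < k1 ∨ t1 Z n k1) := by
      by_cases h : j < k1
      · simp [h]
      · rw [e1 Z n k1 j (not_lt.1 h)]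
    have a2 : (j < k2 ∨ ∃ x < k2, q ≤ x ∧ T2 (n, k2, res Z j) x) ↔
        (j < k2 ∨ ∃ x < k2, q ≤ x ∧ t2 Z n k2 x) := by
      by_cases h : j < k2
      · simp [h]
      · simp only [e2 Z n k2 j _ (not_lt.1 h)]
    rw [a1, a2]
  constructor
  · intro hZ m
    obtain ⟨⟨n, q⟩, rfl⟩ : ∃ p : ℕ × ℕ, Nat.pair p.1 p.2 = m := ⟨m.unpair, Nat.pair_unpair m⟩
    obtain ⟨ha, hb, hc⟩ := hZ n
    have hk1 : ∃ k1, ∀ j, (¬ (n < j ∧ Z n = true) ∨ (j < k1 ∨ t1 Z n k1) ∨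
        ∀ x < j, x < k1 ∨ ¬ t2 Z n j x) := by
      by_cases hn : Z n = true
      · rcases ha hn with ⟨s, hs⟩ | ⟨k, hk⟩
        · exact ⟨s, fun j => .inr (.inl (.inr hs))⟩
        · refine ⟨k, fun j => .inr (.inr fun x _ => ?_)⟩
          by_cases hx : x < k
          · exact .inl hx
          · exact .inr (hk x (not_lt.1 hx) j)
      · exact ⟨0, fun j => .inl fun h => hn h.2⟩
    have hk2 : ∃ k2, ∀ j, (¬ (n < j ∧ Z n = false) ∨ j < k2 ∨
        ∃ x < k2, q ≤ x ∧ t2 Z n k2 x) := by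
      by_cases hn : Z n = false
      · obtain ⟨x, hx, s, hs⟩ := hc hn q
        exact ⟨max s (x + 1), fun j => .inr (.inr ⟨x, by omega, hx,
          m2 _ _ _ _ _ (le_max_left _ _) hs⟩)⟩
      · exact ⟨0, fun j => .inl fun h => hn h.2⟩
    obtain ⟨k1, hk1⟩ := hk1
    obtain ⟨k2, hk2⟩ := hk2
    refine ⟨Nat.pair k1 k2, fun j => ?_⟩
    rw [decide_eq_true_iff]
    refine (hQZ n q k1 k2 j).2 ⟨hk1 j, ?_, hk2 j⟩
    by_cases hn : Z n = false
    · exact .inr (hb hn j)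
    · exact .inl fun h => hn h.2
  · intro hZ n
    have hZ' : ∀ q, ∃ k1 k2, ∀ j, Q (Nat.pair n q, Nat.pair k1 k2, res Z j) := by
      intro q
      obtain ⟨k, hk⟩ := hZ (Nat.pair n q)
      refine ⟨k.unpair.1, k.unpair.2, fun j => ?_⟩
      have := hk j
      rw [decide_eq_true_iff] at this
      rwa [Nat.pair_unpair]
    refine ⟨fun hn => ?_, fun hn s hs => ?_, fun hn q => ?_⟩
    · obtain ⟨k1, k2, hk⟩ := hZ' 0
      by_cases ht : t1 Z n k1
      · exact .inl ⟨k1, ht⟩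
      refine .inr ⟨k1, fun x hx s hs => ?_⟩
      rcases ((hQZ _ _ _ _ (max (max s (x + 1)) (max k1 (n + 1)))).1 (hk _)).1 with h | (h | h) | h
      · exact h ⟨by omega, hn⟩
      · omega
      · exact ht h
      · rcases h x (by omega) with h | h
        · omega
        · exact h (m2 _ _ _ _ _ (by omega) hs)
    · obtain ⟨k1, k2, hk⟩ := hZ' 0
      rcases ((hQZ _ _ _ _ (max s (n + 1))).1 (hk _)).2.1 with h | h
      · exact h ⟨by omega, hn⟩
      · exact h (m1 Z n s _ (le_max_left _ _) hs)
    · obtain ⟨k1, k2, hk⟩ := hZ' q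
      rcases ((hQZ _ _ _ _ (max k2 (n + 1))).1 (hk _)).2.2 with h | h | ⟨x, _, hx, h⟩
      · exact absurd ⟨by omega, hn⟩ h
      · omega
      · exact ⟨x, hx, k2, h⟩

/-- No weakly 3-random set has uniformly introenumerable enumeration degree. -/
theorem stmt_16 (μ : Measure (ℕ → Bool)) (hμ : IsCoinMeasure μ)
    (A : ℕ → Bool) (h : Weak3Random μ A) :
    ¬ ∃ B : Set ℕ, EnumEquiv (toSet A) B ∧ UnifIntroenum B := by
  rintro ⟨B, ⟨⟨WD, hWD, hAB⟩, ⟨WF, hWF, hBA⟩⟩, hBinf, WG, hWG, hG⟩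
  obtain ⟨RD, pD, mD, lD⟩ := hWD.stage
  obtain ⟨RF, pF, mF, lF⟩ := hWF.stage
  obtain ⟨RG, pG, mG, lG⟩ := hWG.stage
  let T2 : ℕ × ℕ × List Bool → ℕ → Prop := fun a => opS RF a.2.1 (baseL a)
  let T1 : ℕ × ℕ × List Bool → Prop := fun a => opS RD a.2.1 (opS RG a.2.1 (T2 a)) a.1
  let t2 : (ℕ → Bool) → ℕ → ℕ → ℕ → Prop := fun Z n s => opS RF s (baseZ n Z s)
  let t1 : (ℕ → Bool) → ℕ → ℕ → Prop := fun Z n s => opS RD s (opS RG s (t2 Z n s)) n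
  have ps : Primrec fun a : ℕ × ℕ × List Bool => a.2.1 := Primrec.fst.comp Primrec.snd
  have h2 : PrimrecRel T2 := primrec_opS pF ps primrec_baseL
  have h1 : PrimrecPred T1 :=
    (primrec_opS pD ps (primrec_opS pG ps h2)).comp Primrec.id Primrec.fst
  have e2 : ∀ Z n s j x, s ≤ j → (T2 (n, s, res Z j) x ↔ t2 Z n s x) := by
    intro Z n s j x hs
    simp only [T2, t2, baseL_res n s j Z hs]
  have e1 : ∀ Z n s j, s ≤ j → (T1 (n, s, res Z j) ↔ t1 Z n s) := by
    intro Z n s j hs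
    simp only [T1, t1, T2, t2, baseL_res n s j Z hs]
  have m2 : ∀ Z n s t x, s ≤ t → t2 Z n s x → t2 Z n t x := fun Z n s t x hst hx =>
    opS_mono mF hst (fun z => baseZ_mono n Z s t z hst) hx
  have mg : ∀ Z n s t x, s ≤ t → opS RG s (t2 Z n s) x → opS RG t (t2 Z n t) x :=
    fun Z n s t x hst hx => opS_mono mG hst (fun z => m2 Z n s t z hst) hx
  have m1 : ∀ Z n s t, s ≤ t → t1 Z n s → t1 Z n t := fun Z n s t hst hx =>
    opS_mono mD hst (fun z => mg Z n s t z hst) hx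
  have hpi := pi03_aux T1 T2 h1 h2 t1 t2 e1 e2 m1 m2
  refine h _ hpi (null_of_flip hμ _ hpi.measurableSet ?_) ?_
  · -- flipping a bit leaves the class
    have c2 : ∀ n Z, baseZ n (flipAt n Z) = baseZ n Z := by
      intro n Z
      funext s x
      apply propext
      by_cases hx : x = n <;> simp [baseZ, flipAt, hx]
    have ct2 : ∀ n Z s, t2 (flipAt n Z) n s = t2 Z n s := by
      intro n Z s; simp only [t2, c2]
    have ct1 : ∀ n Z s, t1 (flipAt n Z) n s = t1 Z n s := by
      intro n Z s; simp only [t1, ct2]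
    have main : ∀ n Z,
        ((∃ s, t1 Z n s) ∨ ∃ k, ∀ x, k ≤ x → ∀ s, ¬ t2 Z n s x) →
        (∀ s, ¬ t1 Z n s) → (∀ q, ∃ x, q ≤ x ∧ ∃ s, t2 Z n s x) → False := by
      rintro n Z (⟨s, hs⟩ | ⟨k, hk⟩) hb hc
      · exact hb s hs
      · obtain ⟨x, hx, s, hs⟩ := hc k
        exact hk x hx s hs
    intro n Z hZ hZ'
    obtain ⟨ha, hb, hc⟩ := hZ n
    obtain ⟨ha', hb', hc'⟩ := hZ' n
    simp only [ct1, ct2] at ha' hb' hc'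
    have hf : flipAt n Z n = !(Z n) := by simp [flipAt]
    rw [hf] at ha' hb' hc'
    cases hn : Z n
    · exact main n Z (ha' (by simp [hn])) (hb hn) (hc hn)
    · exact main n Z (ha hn) (hb' (by simp [hn])) (hc' (by simp [hn]))
  · -- `A` belongs to the class
    intro n
    have l2 : ∀ x, x ∈ enumOp WF (toSet (drop A n)) ↔ ∃ s, t2 A n s x :=
      opS_lim mF lF (baseZ_mono n A) (baseZ_lim n A)
    have l1 : ∀ x, x ∈ enumOp WG (enumOp WF (toSet (drop A n))) ↔
        ∃ s, opS RG s (t2 A n s) x := opS_lim mG lG (m2 A n) l2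
    have l0 : n ∈ enumOp WD (enumOp WG (enumOp WF (toSet (drop A n)))) ↔ ∃ s, t1 A n s :=
      opS_lim mD lD (mg A n) l1 n
    have hsub : toSet (drop A n) ⊆ toSet A := by
      intro z hz
      obtain ⟨s, hs⟩ := (baseZ_lim n A z).1 hz
      exact hs.2.1
    have hFB : enumOp WF (toSet (drop A n)) ⊆ B := by
      rw [hBA]; exact enumOp_mono hsub
    have hinf : (enumOp WF (toSet (drop A n))).Infinite → (A n = true ↔ ∃ s, t1 A n s) := by
      intro hi
      rw [← l0, hG _ hFB hi, ← hAB]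
      exact Iff.rfl
    have hfalse : A n = false → (enumOp WF (toSet (drop A n))).Infinite := by
      intro hn
      have : drop A n = A := by
        funext m
        by_cases hm : m = n
        · simp [drop, hm, hn]
        · simp [drop, hm]
      rw [this, ← hBA]; exact hBinf
    refine ⟨fun hn => ?_, fun hn s hs => ?_, fun hn q => ?_⟩
    · by_cases hi : (enumOp WF (toSet (drop A n))).Infinite
      · exact .inl ((hinf hi).1 hn)
      · obtain ⟨k, hk⟩ := (Set.not_infinite.1 hi).bddAbove
        refine .inr ⟨k + 1, fun x hx s hs => ?_⟩
        have := hk ((l2 x).2 ⟨s, hs⟩)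
        omega
    · have := (hinf (hfalse hn)).2 ⟨s, hs⟩
      rw [hn] at this
      exact absurd this (by simp)
    · obtain ⟨x, hx, hq⟩ := (hfalse hn).exists_gt q
      exact ⟨x, hq.le, (l2 x).1 hx⟩
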